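/- arXiv:0901.2897 — 3 statements merged into one kernel-verified Lean document; each statement's English description precedes it below -/
import Mathlib

section
/- For any word w of length n and any index 1 ≤ i ≤ n−1, π_w[i] = max(π'_w[i], π_w[i+1] − 1) (where the maximum is taken in ℤ, π'_w[i] possibly being −1). In particular, the strong failure function π'_w uniquely determines π_w via this backward recurrence together with π_w[n] = π'_w[n]. -/
/- A word over alphabet `α` is modelled as `w : ℕ → α`, indexed `w 1, …, w n`. -/

/-- `IsBorder w i b`: `b` is the length of a border (possibly non-proper) of the
prefix `w[1..i]`, i.e. `b ≤ i` and `w[1..b] = w[i-b+1..i]`. -/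
def IsBorder {α : Type*} (w : ℕ → α) (i b : ℕ) : Prop :=
  b ≤ i ∧ ∀ t, 1 ≤ t → t ≤ b → w t = w (i - b + t)

/-- The failure function (border array) `π_w[i]`: the length of the longest proper
border of `w[1..i]`. -/
noncomputable def piF {α : Type*} (w : ℕ → α) (i : ℕ) : ℕ :=
  sSup {b | b < i ∧ IsBorder w i b}

/- The strong failure function `π'_w[i]` of a word of length `n`, valued in `ℤ`:
`π'_w[n] = π_w[n]`, and for `i < n` the length of the longest proper border `b` of
`w[1..i]` with `w[b+1] ≠ w[i+1]`, or `-1` if no such border exists. -/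
open Classical in
noncomputable def piF' {α : Type*} (w : ℕ → α) (n i : ℕ) : ℤ :=
  if i = n then (piF w i : ℤ)
  else if ({b | b < i ∧ IsBorder w i b ∧ w (b + 1) ≠ w (i + 1)} : Set ℕ).Nonempty
    then ((sSup {b | b < i ∧ IsBorder w i b ∧ w (b + 1) ≠ w (i + 1)} : ℕ) : ℤ)
    else -1

theorem isBorder_succ_iff {α : Type*} {w : ℕ → α} {i b : ℕ} :
    IsBorder w (i + 1) (b + 1) ↔ IsBorder w i b ∧ w (b + 1) = w (i + 1) := by
  constructor
  · rintro ⟨hle, h⟩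
    refine ⟨⟨by omega, fun t ht htb => ?_⟩, ?_⟩
    · rw [h t ht (by omega)]
      congr 1
      omega
    · rw [h (b + 1) (by omega) le_rfl]
      congr 1
      omega
  · rintro ⟨⟨hle, h⟩, heq⟩
    refine ⟨by omega, fun t ht htb => ?_⟩
    rcases Nat.lt_or_ge b t with hbt | htb'
    · obtain rfl : t = b + 1 := by omega
      rw [heq]
      congr 1
      omega
    · rw [h t ht htb']
      congr 1
      omega

theorem le_piF {α : Type*} {w : ℕ → α} {i b : ℕ} (hb : b < i) (h : IsBorder w i b) :
    b ≤ piF w i :=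
  le_csSup ⟨i, fun _ hc => hc.1.le⟩ ⟨hb, h⟩

theorem piF_spec {α : Type*} (w : ℕ → α) {i : ℕ} (hi : 1 ≤ i) :
    piF w i < i ∧ IsBorder w i (piF w i) :=
  Nat.sSup_mem (s := {b | b < i ∧ IsBorder w i b})
    ⟨0, hi, Nat.zero_le i, fun _ _ _ => by omega⟩ ⟨i, fun _ hc => hc.1.le⟩

theorem piF'_le_piF {α : Type*} (w : ℕ → α) (n i : ℕ) : piF' w n i ≤ piF w i := by
  unfold piF'
  split_ifs with hin hne
  · rfl
  · obtain ⟨hlt, hborder, -⟩ := Nat.sSup_mem hne ⟨i, fun _ hc => hc.1.le⟩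
    exact_mod_cast le_piF hlt hborder
  · omega

theorem le_piF' {α : Type*} {w : ℕ → α} {n i b : ℕ} (hin : i ≠ n) (hb : b < i)
    (h : IsBorder w i b) (hne : w (b + 1) ≠ w (i + 1)) : (b : ℤ) ≤ piF' w n i := by
  have hmem : b ∈ {b | b < i ∧ IsBorder w i b ∧ w (b + 1) ≠ w (i + 1)} := ⟨hb, h, hne⟩
  rw [piF', if_neg hin, if_pos ⟨b, hmem⟩]
  exact_mod_cast le_csSup ⟨i, fun _ hc => hc.1.le⟩ hmem

theorem piF_succ_le {α : Type*} (w : ℕ → α) (i : ℕ) : piF w (i + 1) ≤ piF w i + 1 := by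
  obtain ⟨hlt, hborder⟩ := piF_spec w (Nat.le_add_left 1 i)
  cases hc : piF w (i + 1) with
  | zero => omega
  | succ c =>
    rw [hc] at hlt hborder
    have := le_piF (by omega) (isBorder_succ_iff.1 hborder).1
    omega

/-- For `1 ≤ i ≤ n-1`, `π_w[i] = max(π'_w[i], π_w[i+1] - 1)` (maximum in `ℤ`);
together with `π_w[n] = π'_w[n]`, this backward recurrence shows that `π'_w`
uniquely determines `π_w`. -/
theorem pi_from_pi' {α : Type*} (w : ℕ → α) (n i : ℕ) (h1 : 1 ≤ i) (h2 : i ≤ n - 1) :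
    ((piF w i : ℤ) = max (piF' w n i) ((piF w (i + 1) : ℤ) - 1)) ∧
    (piF w n : ℤ) = piF' w n n := by
  refine ⟨le_antisymm ?_ (max_le (piF'_le_piF w n i) ?_), by simp [piF']⟩
  · obtain ⟨hlt, hborder⟩ := piF_spec w h1
    by_cases heq : w (piF w i + 1) = w (i + 1)
    · have := le_piF (by omega) (isBorder_succ_iff.2 ⟨hborder, heq⟩)
      exact le_max_of_le_right (by omega)
    · exact le_max_of_le_left (le_piF' (by omega) hlt hborder heq)
  · have := piF_succ_le w i
    omega
end

section
/- Let w be a word of length n and define f'(i) = π'_w[i−1] + 1 for 2 ≤ i ≤ n (defined when π'_w[i−1] ≥ 0). Then for every index i such that f'(i), f'^{(2)}(i) and f'^{(3)}(i) are all defined, 2·f'^{(3)}(i) < f'(i). -/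
/-- `f'(i) = π'_w[i-1] + 1` (meaningful when `2 ≤ i` and `π'_w[i-1] ≥ 0`). -/
noncomputable def fF' {α : Type*} (w : ℕ → α) (n i : ℕ) : ℕ :=
  (piF' w n (i - 1) + 1).toNat

/-- `fDef' w n i k`: the iterate `f'^{(k)}(i)` is defined, i.e. all the intermediate
arguments are `≥ 2` and the corresponding values of `π'` are `≥ 0`. -/
def fDef' {α : Type*} (w : ℕ → α) (n i k : ℕ) : Prop :=
  ∀ j < k, 2 ≤ (fF' w n)^[j] i ∧ 0 ≤ piF' w n ((fF' w n)^[j] i - 1)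

/-- A nonnegative value `π'_w[i]` at `i ≠ n` is attained by a proper border of `w[1..i]` after
which the next letters differ. -/
theorem exists_border_of_piF'_nonneg {α : Type*} {w : ℕ → α} {n i : ℕ} (hi : i ≠ n)
    (h : 0 ≤ piF' w n i) :
    ∃ b : ℕ, piF' w n i = b ∧ b < i ∧ IsBorder w i b ∧ w (b + 1) ≠ w (i + 1) := by
  by_cases hne : ({b | b < i ∧ IsBorder w i b ∧ w (b + 1) ≠ w (i + 1)} : Set ℕ).Nonempty
  · exact ⟨_, by rw [piF', if_neg hi, if_pos hne],
      Nat.sSup_mem hne ⟨i, fun _ hb => hb.1.le⟩⟩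
  · rw [piF', if_neg hi, if_neg hne] at h
    omega

/-- If `b` is a proper border of `w[1..a]` and `c` is a proper border of `w[1..b]` that does not
extend to a border of `w[1..b+1]`, then `2 (c + 1) ≤ a`. -/
theorem IsBorder.two_mul_succ_le {α : Type*} {w : ℕ → α} {a b c : ℕ} (hba : b < a)
    (hab : IsBorder w a b) (hcb : c < b) (hbc : IsBorder w b c) (hne : w (c + 1) ≠ w (b + 1)) :
    2 * (c + 1) ≤ a := by
  by_contra! hlt
  obtain ⟨p, rfl⟩ := Nat.exists_eq_add_of_lt hba
  obtain ⟨q, rfl⟩ := Nat.exists_eq_add_of_lt hcb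
  obtain ⟨t, rfl⟩ : ∃ t, c = p + 1 + t - 1 := ⟨c - p, by omega⟩
  have h₁ := hab.2 (t + q + 1) (by omega) (by omega)
  have h₂ := hab.2 t (by omega) (by omega)
  have h₃ := hbc.2 t (by omega) (by omega)
  apply hne
  convert h₂.symm.trans (h₃.trans (Eq.trans ?_ h₁)) using 2 <;> first | omega | (congr 1; omega)

/-- If `f'(i)`, `f'^{(2)}(i)` and `f'^{(3)}(i)` are all defined, then
`2 · f'^{(3)}(i) < f'(i)`. -/
theorem pi'_cube {α : Type*} (w : ℕ → α) (n i : ℕ) (hi : i ≤ n)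
    (hdef : fDef' w n i 3) :
    2 * (fF' w n)^[3] i < fF' w n i := by
  have h₀ := hdef 0 (by omega)
  have h₁ := hdef 1 (by omega)
  have h₂ := hdef 2 (by omega)
  simp only [Function.iterate_succ, Function.iterate_zero, Function.comp_apply, id] at *
  obtain ⟨a, ha, hai, -, -⟩ := exists_border_of_piF'_nonneg (by omega) h₀.2
  have hfa : fF' w n i = a + 1 := by rw [fF', ha]; omega
  rw [hfa] at h₁ h₂ ⊢
  obtain ⟨b, hb, hba, hab, -⟩ := exists_border_of_piF'_nonneg (by omega) h₁.2
  have hfb : fF' w n (a + 1) = b + 1 := by rw [fF', hb]; omega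
  rw [hfb] at h₂ ⊢
  obtain ⟨c, hc, hcb, hbc, hne⟩ := exists_border_of_piF'_nonneg (by omega) h₂.2
  have hfc : fF' w n (b + 1) = c + 1 := by rw [fF', hc]; omega
  rw [hfc]
  simp only [Nat.add_sub_cancel] at *
  have := hab.two_mul_succ_le hba hcb hbc hne
  omega
end

section
/- Let w be a word of length n and π' = π'_w. For every k ≥ 0 and every segment of 2^k consecutive indices {s, s+1, …, s+2^k−1} ⊆ {1, …, n}, the set of values { π'[j] : s ≤ j ≤ s+2^k−1 } ∩ [2^k, 2^{k+1}) has cardinality at most 48. -/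
/-- `MaxMatch w p b`: the longest common prefix of `w[1..]` and `w[p+1..]` has length `b`. -/
def MaxMatch {α : Type*} (w : ℕ → α) (p b : ℕ) : Prop :=
  (∀ t, 1 ≤ t → t ≤ b → w t = w (p + t)) ∧ w (b + 1) ≠ w (p + (b + 1))

lemma MaxMatch.unique {α : Type*} {w : ℕ → α} {p b c : ℕ}
    (h : MaxMatch w p b) (hc : MaxMatch w p c) : b = c := by
  rcases lt_trichotomy b c with hlt | heq | hlt
  · exact absurd (hc.1 (b + 1) (by omega) (by omega)) h.2
  · exact heq
  · exact absurd (h.1 (c + 1) (by omega) (by omega)) hc.2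

/-- Suppose `w[1..K]` has period `q`, and consider the positions where the period `q` is
broken: the first one, `e`, in `w`, and the first one, `f`, after position `d`. A match
of length `b ≥ K` at an offset `p ≤ d` close to `d` is governed by `e` and `f`. -/
lemma MaxMatch.trichotomy {α : Type*} {w : ℕ → α} {p b q K d : ℕ}
    (h : MaxMatch w p b) (hK : K ≤ b) (hq : 1 ≤ q) (hpd : p ≤ d) (hd : d + q ≤ p + K)
    (hper : ∀ t, 1 ≤ t → t + q ≤ K → w t = w (t + q)) :
    b + 1 = sInf {t | 1 ≤ t ∧ w t ≠ w (t + q)} + q ∨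
    p + b + 1 = sInf {t | d < t ∧ w t ≠ w (t + q)} + q ∨
    p + sInf {t | 1 ≤ t ∧ w t ≠ w (t + q)} = sInf {t | d < t ∧ w t ≠ w (t + q)} := by
  set E := {t | 1 ≤ t ∧ w t ≠ w (t + q)} with hE
  set F := {t | d < t ∧ w t ≠ w (t + q)} with hF
  have shift : ∀ t, 1 ≤ t → t + q ≤ b → (t ∈ E ↔ p + t ∈ F) := by
    intro t ht htb
    have h1 := h.1 t ht (by omega)
    have h2 := h.1 (t + q) (by omega) htb
    simp only [hE, hF, Set.mem_ofPred_eq, ht, true_and, add_assoc, ← h1, ← h2]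
    refine ⟨fun hne => ⟨?_, hne⟩, fun hne => hne.2⟩
    by_contra hlt
    exact hne (hper t ht (by omega))
  obtain ⟨r, hr⟩ : ∃ r, r + q = b + 1 := ⟨b + 1 - q, by omega⟩
  have hr1 : 1 ≤ r := by omega
  have hwr := h.1 r hr1 (by omega)
  have hrEF : r ∈ E ∨ p + r ∈ F := by
    by_contra hno
    push Not at hno
    have h1 : w r = w (r + q) := by
      by_contra hne
      exact hno.1 ⟨hr1, hne⟩
    have h2 : w (p + r) = w (p + r + q) := by
      by_contra hne
      refine hno.2 ⟨?_, hne⟩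
      omega
    apply h.2
    rw [← hr, ← h1, hwr, h2, add_assoc]
  by_cases hfirst : ∃ t, 1 ≤ t ∧ t < r ∧ t ∈ E
  · obtain ⟨t, ht1, htr, htE⟩ := hfirst
    right; right
    have heE : sInf E ∈ E := Nat.sInf_mem ⟨t, htE⟩
    have het : sInf E ≤ t := Nat.sInf_le htE
    have heF : p + sInf E ∈ F := (shift _ heE.1 (by omega)).1 heE
    refine le_antisymm ?_ (Nat.sInf_le heF)
    have hfF : sInf F ∈ F := Nat.sInf_mem ⟨_, heF⟩
    have hfle : sInf F ≤ p + sInf E := Nat.sInf_le heF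
    have hfd := hfF.1
    obtain ⟨u, hu⟩ : ∃ u, sInf F = p + u := ⟨sInf F - p, by omega⟩
    have huE : u ∈ E := (shift u (by omega) (by omega)).2 (hu ▸ hfF)
    have := Nat.sInf_le huE
    omega
  · push Not at hfirst
    rcases hrEF with hrE | hrF
    · left
      have hle := Nat.sInf_le hrE
      have heE : sInf E ∈ E := Nat.sInf_mem ⟨r, hrE⟩
      have : ¬ sInf E < r := fun hlt => hfirst _ heE.1 hlt heE
      omega
    · right; left
      have hle := Nat.sInf_le hrF
      have hfF : sInf F ∈ F := Nat.sInf_mem ⟨_, hrF⟩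
      have hfd := hfF.1
      obtain ⟨u, hu⟩ : ∃ u, sInf F = p + u := ⟨sInf F - p, by omega⟩
      have : ¬ u < r := fun hlt =>
        hfirst u (by omega) hlt ((shift u (by omega) (by omega)).2 (hu ▸ hfF))
      omega

/-- If `w[1..K]` occurs at offsets `p` and `p + q`, it has period `q`. -/
lemma period_of_matches {α : Type*} {w : ℕ → α} {p q b b' K : ℕ}
    (h : MaxMatch w p b) (h' : MaxMatch w (p + q) b') (hb : K ≤ b) (hb' : K ≤ b') :
    ∀ t, 1 ≤ t → t + q ≤ K → w t = w (t + q) := by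
  intro t ht htq
  rw [h'.1 t ht (by omega), h.1 (t + q) (by omega) (by omega)]
  congr 1
  omega

/-- Long matches at offsets in a short window, with at most one match per end position,
have at most three different lengths. -/
lemma encard_match_lengths_le {α : Type*} {w : ℕ → α} {K c d : ℕ} (T : ℕ → ℕ → Prop)
    (hd : 2 * d ≤ 2 * c + K)
    (hT : ∀ p b, T p b → MaxMatch w p b ∧ K ≤ b ∧ c ≤ p ∧ p ≤ d)
    (hend : ∀ p b p' b', T p b → T p' b' → p + b = p' + b' → b = b') :
    {b | ∃ p, T p b}.encard ≤ 3 := by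
  by_cases hsame : ∀ p b p' b', T p b → T p' b' → ¬ p < p'
  · refine (Set.encard_le_one_iff_subsingleton.2 ?_).trans (by norm_num)
    rintro b ⟨p, hp⟩ b' ⟨p', hp'⟩
    have h1 := hsame _ _ _ _ hp hp'
    have h2 := hsame _ _ _ _ hp' hp
    obtain rfl : p = p' := by omega
    exact (hT _ _ hp).1.unique (hT _ _ hp').1
  · push Not at hsame
    obtain ⟨p₁, b₁, p₂, b₂, hT₁, hT₂, hlt⟩ := hsame
    obtain ⟨q, rfl⟩ := Nat.exists_eq_add_of_lt hlt
    obtain ⟨hm₁, hK₁, hc₁, hd₁⟩ := hT _ _ hT₁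
    obtain ⟨hm₂, hK₂, hc₂, hd₂⟩ := hT _ _ hT₂
    have hper := period_of_matches (q := q + 1) hm₁ hm₂ hK₁ hK₂
    set e := sInf {t | 1 ≤ t ∧ w t ≠ w (t + (q + 1))}
    set f := sInf {t | d < t ∧ w t ≠ w (t + (q + 1))}
    have hsub : {b | ∃ p, T p b} ⊆
        {b | b + 1 = e + (q + 1)} ∪ {b | ∃ p, T p b ∧ p + b + 1 = f + (q + 1)} ∪
          {b | ∃ p, T p b ∧ p + e = f} := by
      rintro b ⟨p, hp⟩
      obtain ⟨hm, hK, hc, hpd⟩ := hT _ _ hp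
      rcases hm.trichotomy hK (by omega) hpd (by omega) hper with h | h | h
      · exact Or.inl (Or.inl h)
      · exact Or.inl (Or.inr ⟨p, hp, h⟩)
      · exact Or.inr ⟨p, hp, h⟩
    have h1 : {b | b + 1 = e + (q + 1)}.encard ≤ 1 := by
      refine Set.encard_le_one_iff_subsingleton.2 ?_
      intro b hb b' hb'
      simp only [Set.mem_ofPred_eq] at hb hb'
      omega
    have h2 : {b | ∃ p, T p b ∧ p + b + 1 = f + (q + 1)}.encard ≤ 1 := by
      refine Set.encard_le_one_iff_subsingleton.2 ?_
      rintro b ⟨p, hp, hb⟩ b' ⟨p', hp', hb'⟩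
      exact hend _ _ _ _ hp hp' (by omega)
    have h3 : {b | ∃ p, T p b ∧ p + e = f}.encard ≤ 1 := by
      refine Set.encard_le_one_iff_subsingleton.2 ?_
      rintro b ⟨p, hp, hb⟩ b' ⟨p', hp', hb'⟩
      obtain rfl : p = p' := by omega
      exact (hT _ _ hp).1.unique (hT _ _ hp').1
    calc _ ≤ _ := Set.encard_le_encard hsub
      _ ≤ _ := Set.encard_union_le _ _
      _ ≤ _ := add_le_add_left (Set.encard_union_le _ _) _
      _ ≤ 1 + 1 + 1 := add_le_add (add_le_add h1 h2) h3
      _ = 3 := by norm_num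

/-- A nonnegative value of the strong failure function comes from a maximal match. -/
lemma exists_maxMatch_of_piF' {α : Type*} {w : ℕ → α} {n j : ℕ} (hj : j ≠ n)
    (h0 : 0 ≤ piF' w n j) :
    ∃ p b : ℕ, piF' w n j = b ∧ p + b = j ∧ 1 ≤ p ∧ MaxMatch w p b := by
  unfold piF' at h0 ⊢
  rw [if_neg hj] at h0 ⊢
  split_ifs at h0 ⊢ with hne
  · have hmem := Nat.sSup_mem hne ⟨j, fun b hb => hb.1.le⟩
    set b := sSup {b | b < j ∧ IsBorder w j b ∧ w (b + 1) ≠ w (j + 1)}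
    obtain ⟨hbj, hb, hmis⟩ := hmem
    refine ⟨j - b, b, rfl, by omega, by omega, hb.2, ?_⟩
    rwa [show j - b + (b + 1) = j + 1 by omega]
  · omega

/-- In any segment of `2^k` consecutive indices of the `π'` array, at most `48`
different values from `[2^k, 2^{k+1})` occur. -/
theorem few_different {α : Type*} (w : ℕ → α) (n k s : ℕ)
    (hs : 1 ≤ s) (hn : s + 2 ^ k - 1 ≤ n) :
    ({v : ℤ | ∃ j, s ≤ j ∧ j ≤ s + 2 ^ k - 1 ∧ v = piF' w n j} ∩
      Set.Ico ((2 : ℤ) ^ k) ((2 : ℤ) ^ (k + 1))).ncard ≤ 48 := by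
  refine ENat.toNat_le_of_le_natCast ?_
  rcases k with _ | m
  · refine (Set.encard_le_one_iff_subsingleton.2 ?_).trans (by norm_num)
    rintro v ⟨-, hv⟩ v' ⟨-, hv'⟩
    simp only [Set.mem_Ico] at hv hv'
    omega
  obtain ⟨H, hH⟩ : ∃ H, H = 2 ^ m := ⟨_, rfl⟩
  have hHpos : 1 ≤ H := hH ▸ Nat.one_le_two_pow
  have hZ : (2 : ℤ) ^ m = H := by rw [hH]; norm_cast
  have hN1 : 2 ^ (m + 1) = 2 * H := by rw [hH]; ring
  have hZ1 : (2 : ℤ) ^ (m + 1) = 2 * H := by rw [pow_succ, hZ]; ring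
  have hZ2 : (2 : ℤ) ^ (m + 1 + 1) = 4 * H := by rw [pow_succ, hZ1]; ring
  rw [hN1] at hn ⊢
  rw [hZ1, hZ2]
  let T (i p b : ℕ) : Prop :=
    MaxMatch w p b ∧ 2 * H ≤ b ∧ s + i * H ≤ p + 4 * H ∧ p + 4 * H < s + (i + 1) * H ∧
      piF' w n (p + b) = b
  let B (i : ℕ) : Set ℤ := Nat.cast '' {b : ℕ | ∃ p, T i p b}
  have hB : ∀ i, (B i).encard ≤ 3 := by
    intro i
    refine (Set.encard_image_le _ _).trans ?_
    refine encard_match_lengths_le (w := w) (K := 2 * H) (c := s + i * H - 4 * H)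
      (d := s + (i + 1) * H - 4 * H - 1) (T i) ?_ ?_ ?_
    · rw [add_one_mul]
      omega
    · rintro p b ⟨hm, hb, h1, h2, -⟩
      exact ⟨hm, hb, by omega, by omega⟩
    · rintro p b p' b' ⟨-, -, -, -, h⟩ ⟨-, -, -, -, h'⟩ heq
      rw [heq, h'] at h
      exact_mod_cast h.symm
  have hsub : ({v : ℤ | ∃ j, s ≤ j ∧ j ≤ s + 2 * H - 1 ∧ v = piF' w n j} ∩
      Set.Ico (2 * (H : ℤ)) (4 * H)) ⊆ {piF' w n n} ∪ (B 0 ∪ B 1 ∪ (B 2 ∪ B 3)) := by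
    rintro v ⟨⟨j, hsj, hjs, rfl⟩, hv1, hv2⟩
    by_cases hjn : j = n
    · subst hjn
      exact Or.inl rfl
    right
    obtain ⟨p, b, hpb, rfl, hp, hm⟩ := exists_maxMatch_of_piF' (w := w) hjn (by omega)
    rw [hpb] at hv1 hv2 ⊢
    have mem : ∀ i, s + i * H ≤ p + 4 * H → p + 4 * H < s + (i + 1) * H → (b : ℤ) ∈ B i :=
      fun i h1 h2 => ⟨b, ⟨p, hm, by omega, h1, h2, hpb⟩, rfl⟩
    by_cases c1 : p + 4 * H < s + 1 * H
    · exact Or.inl (Or.inl (mem 0 (by omega) (by omega)))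
    by_cases c2 : p + 4 * H < s + 2 * H
    · exact Or.inl (Or.inr (mem 1 (by omega) (by omega)))
    by_cases c3 : p + 4 * H < s + 3 * H
    · exact Or.inr (Or.inl (mem 2 (by omega) (by omega)))
    · exact Or.inr (Or.inr (mem 3 (by omega) (by omega)))
  calc _ ≤ _ := Set.encard_le_encard hsub
    _ ≤ _ := Set.encard_union_le _ _
    _ ≤ 1 + (3 + 3 + (3 + 3)) := by
        refine add_le_add (Set.encard_singleton _).le ((Set.encard_union_le _ _).trans ?_)
        exact add_le_add ((Set.encard_union_le _ _).trans (add_le_add (hB 0) (hB 1)))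
          ((Set.encard_union_le _ _).trans (add_le_add (hB 2) (hB 3)))
    _ ≤ _ := by norm_num
end
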